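/- Let λ ≥ 1, let 1 < α < 2 and let W ∈ L^{2α'}(0,1) with 1/α + 1/α' = 1. Suppose K : [0,1]² → ℂ satisfies |K(s,t)| ≤ (1 + λ|s-t|)^{-1/2}. Then ( ∫_0^1 ( ∫_0^1 |W(s) K(s,t) W(t)|^α ds )^{α'/α} dt )^{1/α'} ≤ C_α λ^{-1/2} ‖W‖_{L^{2α'}(0,1)}², for a constant C_α independent of λ and W. -/

import Mathlib

open MeasureTheory

/-- A weighted form of Jensen's inequality for the measure with density `k`. -/
theorem lintegral_mul_rpow_le_of_lintegral_le {X : Type*} [MeasurableSpace X] {μ : Measure X}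
    {f k : X → ENNReal} (hf : Measurable f) (hk : Measurable k) {M : ENNReal} {r : ℝ} (hr : 1 < r)
    (hM : ∫⁻ s, k s ∂μ ≤ M) :
    (∫⁻ s, f s * k s ∂μ) ^ r ≤ M ^ (r - 1) * ∫⁻ s, f s ^ r * k s ∂μ := by
  have h0 : 0 < r := by linarith
  have hc := Real.HolderConjugate.conjExponent hr
  set r' := r.conjExponent
  have h0' : 0 < r' := hc.symm.pos
  have hsum : 1 / r + 1 / r' = 1 := by simpa using hc.inv_add_inv_eq_one
  have h := ENNReal.lintegral_mul_le_Lp_mul_Lq μ hc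
    (f := fun s => f s * k s ^ (1 / r)) (g := fun s => k s ^ (1 / r'))
    (by fun_prop) (by fun_prop)
  have e1 : ∀ s, ((fun s => f s * k s ^ (1 / r)) * (fun s => k s ^ (1 / r'))) s = f s * k s := by
    intro s
    simp only [Pi.mul_apply]
    rw [mul_assoc, ← ENNReal.rpow_add_of_nonneg _ _ (by positivity) (by positivity), hsum,
      ENNReal.rpow_one]
  have e2 : ∀ s, (f s * k s ^ (1 / r)) ^ r = f s ^ r * k s := by
    intro s
    rw [ENNReal.mul_rpow_of_nonneg _ _ h0.le, ← ENNReal.rpow_mul, one_div_mul_cancel h0.ne',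
      ENNReal.rpow_one]
  have e3 : ∀ s, (k s ^ (1 / r')) ^ r' = k s := by
    intro s
    rw [← ENNReal.rpow_mul, one_div_mul_cancel h0'.ne', ENNReal.rpow_one]
  simp only [e1, e2, e3] at h
  have hexp : 1 / r' * r = r - 1 := by
    have : 1 / r' = 1 - 1 / r := by linarith
    rw [this]; field_simp
  calc _ ≤ ((∫⁻ s, f s ^ r * k s ∂μ) ^ (1 / r) * (∫⁻ s, k s ∂μ) ^ (1 / r')) ^ r :=
        ENNReal.rpow_le_rpow h h0.le
    _ = (∫⁻ s, k s ∂μ) ^ (r - 1) * ∫⁻ s, f s ^ r * k s ∂μ := by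
        rw [ENNReal.mul_rpow_of_nonneg _ _ h0.le, ← ENNReal.rpow_mul, ← ENNReal.rpow_mul,
          one_div_mul_cancel h0.ne', ENNReal.rpow_one, hexp, mul_comm]
    _ ≤ _ := by gcongr

theorem ENNReal.mul_le_sq_add_sq (a b : ENNReal) : a * b ≤ a ^ 2 + b ^ 2 := by
  rcases le_total a b with h | h
  · calc a * b ≤ b * b := by gcongr
      _ = b ^ 2 := (sq b).symm
      _ ≤ _ := le_add_self
  · calc a * b ≤ a * a := by gcongr
      _ = a ^ 2 := (sq a).symm
      _ ≤ _ := le_self_add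

/-- A Schur-type test for the bilinear expression `f t * ∫ f s * k s t`. -/
theorem lintegral_mul_lintegral_rpow_le {X : Type*} [MeasurableSpace X] {μ : Measure X} [SFinite μ]
    {f : X → ENNReal} {k : X → X → ENNReal} (hf : Measurable f)
    (hk : Measurable (Function.uncurry k)) {M : ENNReal} {r : ℝ} (hr : 1 < r)
    (hM : ∀ᵐ t ∂μ, ∫⁻ s, k s t ∂μ ≤ M) (hM' : ∀ᵐ s ∂μ, ∫⁻ t, k s t ∂μ ≤ M) :
    ∫⁻ t, (f t * ∫⁻ s, f s * k s t ∂μ) ^ r ∂μ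
      ≤ M ^ (r - 1) * (2 * M * ∫⁻ t, f t ^ (2 * r) ∂μ) := by
  have h0 : 0 < r := by linarith
  have hk1 : ∀ t, Measurable fun s => k s t := fun t => hk.comp measurable_prodMk_right
  have hk2 : ∀ s, Measurable fun t => k s t := fun s => hk.comp measurable_prodMk_left
  have hks : Measurable fun p : X × X => k p.2 p.1 := hk.comp measurable_swap
  have hsq : ∀ t, (f t ^ r) ^ 2 = f t ^ (2 * r) := by
    intro t
    rw [← ENNReal.rpow_natCast, ← ENNReal.rpow_mul]; congr 1; push_cast; ring
  have hpt : ∀ᵐ t ∂μ, (f t * ∫⁻ s, f s * k s t ∂μ) ^ r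
      ≤ M ^ (r - 1) * ((f t ^ (2 * r) * ∫⁻ s, k s t ∂μ) + ∫⁻ s, f s ^ (2 * r) * k s t ∂μ) := by
    filter_upwards [hM] with t ht
    rw [ENNReal.mul_rpow_of_nonneg _ _ h0.le]
    calc _ ≤ f t ^ r * (M ^ (r - 1) * ∫⁻ s, f s ^ r * k s t ∂μ) := by
          gcongr; exact lintegral_mul_rpow_le_of_lintegral_le hf (hk1 t) hr ht
      _ = M ^ (r - 1) * ∫⁻ s, f t ^ r * (f s ^ r * k s t) ∂μ := by
          rw [lintegral_const_mul _ (by have := hk1 t; fun_prop)]; ring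
      _ ≤ M ^ (r - 1) * ∫⁻ s, (f t ^ (2 * r) * k s t + f s ^ (2 * r) * k s t) ∂μ := by
          gcongr with s
          rw [← mul_assoc, ← add_mul, ← hsq, ← hsq]
          gcongr
          exact ENNReal.mul_le_sq_add_sq _ _
      _ = _ := by
          rw [lintegral_add_left ((hk1 t).const_mul _), lintegral_const_mul _ (hk1 t)]
  have hmeas1 : Measurable fun t => f t ^ (2 * r) * ∫⁻ s, k s t ∂μ :=
    (hf.pow_const _).mul hks.lintegral_prod_right'
  have hmeas2' : Measurable fun p : X × X => f p.2 ^ (2 * r) * k p.2 p.1 :=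
    ((hf.comp measurable_snd).pow_const _).mul hks
  have hmeas2 : Measurable fun t => ∫⁻ s, f s ^ (2 * r) * k s t ∂μ := hmeas2'.lintegral_prod_right'
  refine (lintegral_mono_ae hpt).trans ?_
  rw [lintegral_const_mul _ (by fun_prop), lintegral_add_left hmeas1]
  gcongr
  rw [two_mul M, add_mul]
  gcongr
  · rw [← lintegral_const_mul _ (hf.pow_const _)]
    refine lintegral_mono_ae ?_
    filter_upwards [hM] with t ht
    rw [mul_comm]
    gcongr
  · rw [lintegral_lintegral_swap hmeas2'.aemeasurable, ← lintegral_const_mul _ (hf.pow_const _)]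
    refine lintegral_mono_ae ?_
    filter_upwards [hM'] with s hs
    rw [lintegral_const_mul _ (hk2 s), mul_comm]
    gcongr

theorem lintegral_abs_rpow_neg_lt_top {a : ℝ} (ha : a < 1) :
    ∫⁻ u in Set.Ioc (-1 : ℝ) 1, ENNReal.ofReal (|u| ^ (-a)) < ⊤ := by
  have h1 : IntervalIntegrable (fun u : ℝ => |u| ^ (-a)) volume 0 1 := by
    refine (intervalIntegral.intervalIntegrable_rpow' (r := -a) (by linarith)).congr ?_
    intro u hu
    rw [Set.uIoc_of_le zero_le_one] at hu
    simp only [abs_of_pos hu.1]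
  have h2 : IntervalIntegrable (fun u : ℝ => |u| ^ (-a)) volume (-1) 0 := by
    rw [IntervalIntegrable.iff_comp_neg]
    simpa using h1.symm
  have h := h2.trans h1
  rw [intervalIntegrable_iff_integrableOn_Ioc_of_le (by norm_num)] at h
  exact h.lintegral_lt_top

/-- Uniform bound for the integral of `(1 + l * |s - t|) ^ (-a)` over the unit interval. -/
theorem lintegral_one_add_mul_abs_sub_rpow_neg_le {a l t : ℝ} (ha : 0 ≤ a) (hl : 0 < l)
    (ht : t ∈ Set.Ioc (0 : ℝ) 1) :
    ∫⁻ s in Set.Ioc (0 : ℝ) 1, ENNReal.ofReal ((1 + l * |s - t|) ^ (-a))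
      ≤ ENNReal.ofReal (l ^ (-a)) *
        ∫⁻ u in Set.Ioc (-1 : ℝ) 1, ENNReal.ofReal (|u| ^ (-a)) := by
  rw [← lintegral_indicator measurableSet_Ioc, ← lintegral_indicator measurableSet_Ioc,
    ← lintegral_sub_right_eq_self
      ((Set.Ioc (-1 : ℝ) 1).indicator fun u => ENNReal.ofReal (|u| ^ (-a))) t,
    ← lintegral_const_mul']
  swap
  · exact ENNReal.ofReal_ne_top
  refine lintegral_mono_ae ?_
  filter_upwards [compl_mem_ae_iff.2 (measure_singleton t)] with s hs
  have hs' : s - t ≠ 0 := sub_ne_zero.2 hs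
  by_cases h : s ∈ Set.Ioc (0 : ℝ) 1
  · have h' : s - t ∈ Set.Ioc (-1 : ℝ) 1 := ⟨by linarith [h.1, ht.2], by linarith [h.2, ht.1]⟩
    rw [Set.indicator_of_mem h, Set.indicator_of_mem h',
      ← ENNReal.ofReal_mul (by positivity), ← Real.mul_rpow hl.le (abs_nonneg _)]
    refine ENNReal.ofReal_le_ofReal (Real.rpow_le_rpow_of_nonpos ?_ ?_ (by linarith))
    · positivity
    · linarith
  · rw [Set.indicator_of_notMem h]
    exact zero_le

theorem stmt8 (α α' : ℝ) (hα1 : 1 < α) (hα2 : α < 2) (hconj : 1 / α + 1 / α' = 1) :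
    ∃ C > 0, ∀ l : ℝ, 1 ≤ l → ∀ (W : ℝ → ℂ) (K : ℝ → ℝ → ℂ),
      Measurable W →
      IntegrableOn (fun s => ‖W s‖ ^ (2 * α')) (Set.Ioc (0 : ℝ) 1) →
      (∀ s ∈ Set.Icc (0 : ℝ) 1, ∀ t ∈ Set.Icc (0 : ℝ) 1,
        ‖K s t‖ ≤ (1 + l * |s - t|) ^ (-(1/2 : ℝ))) →
      (∫ t in Set.Ioc (0 : ℝ) 1,
          (∫ s in Set.Ioc (0 : ℝ) 1, ‖W s * K s t * W t‖ ^ α) ^ (α' / α)) ^ (1 / α')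
        ≤ C * l ^ (-(1/2 : ℝ)) *
            (∫ s in Set.Ioc (0 : ℝ) 1, ‖W s‖ ^ (2 * α')) ^ (1 / α') := by
  have hα0 : 0 < α := by linarith
  have hα'lt : α < α' := by
    have h1 : 1 / 2 < 1 / α := one_div_lt_one_div_of_lt hα0 hα2
    have h2 : 1 / α < 1 := by rw [div_lt_one hα0]; exact hα1
    have h3 : 0 < 1 / α' := by linarith
    have h4 : 0 < α' := one_div_pos.1 h3
    have h5 : 1 / α' < 1 / 2 := by linarith
    have h6 : 2 < α' := (one_div_lt_one_div h4 two_pos).1 h5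
    linarith
  have hα'0 : 0 < α' := by linarith
  have hr : 1 < α' / α := by rwa [one_lt_div hα0]
  have hr0 : 0 < α' / α := by linarith
  have hfin := lintegral_abs_rpow_neg_lt_top (a := α / 2) (by linarith)
  set c := ∫⁻ u in Set.Ioc (-1 : ℝ) 1, ENNReal.ofReal (|u| ^ (-(α / 2))) with hc
  have hc1 : 0 < c.toReal + 1 := by positivity
  have hcle : c ≤ ENNReal.ofReal (c.toReal + 1) := by
    rw [← ENNReal.ofReal_toReal hfin.ne]
    exact ENNReal.ofReal_le_ofReal (by simp)
  set d := c.toReal + 1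
  refine ⟨(2 * d ^ (α' / α)) ^ (1 / α'), by positivity, ?_⟩
  intro l hl W K hW hint hK
  have hl0 : 0 < l := by linarith
  set μ := volume.restrict (Set.Ioc (0 : ℝ) 1) with hμ
  set f : ℝ → ENNReal := fun s => ENNReal.ofReal (‖W s‖ ^ α) with hf
  set k : ℝ → ℝ → ENNReal := fun s t => ENNReal.ofReal ((1 + l * |s - t|) ^ (-(α / 2))) with hk
  have hfm : Measurable f := by fun_prop
  have hkm : Measurable (Function.uncurry k) := by
    simp only [hk, Function.uncurry_def]; fun_prop
  set m := l ^ (-(α / 2)) * d with hm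
  have hm0 : 0 < m := by positivity
  have hM : ∀ᵐ t ∂μ, ∫⁻ s, k s t ∂μ ≤ ENNReal.ofReal m := by
    filter_upwards [ae_restrict_mem measurableSet_Ioc] with t ht
    refine (lintegral_one_add_mul_abs_sub_rpow_neg_le (by positivity) hl0 ht).trans ?_
    rw [hm, ENNReal.ofReal_mul (by positivity)]
    gcongr
  have hM' : ∀ᵐ s ∂μ, ∫⁻ t, k s t ∂μ ≤ ENNReal.ofReal m := by
    simpa only [hk, abs_sub_comm] using hM
  have key := lintegral_mul_lintegral_rpow_le hfm hkm hr hM hM'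
  have hfp : ∀ s, f s ^ (2 * (α' / α)) = ENNReal.ofReal (‖W s‖ ^ (2 * α')) := by
    intro s
    simp only [hf]
    rw [ENNReal.ofReal_rpow_of_nonneg (by positivity) (by positivity), ← Real.rpow_mul (by positivity)]
    congr 2; field_simp
  simp only [hfp] at key
  rw [← ofReal_integral_eq_lintegral_ofReal hint
    (Filter.Eventually.of_forall fun s => by positivity)] at key
  set B := ∫ s, ‖W s‖ ^ (2 * α') ∂μ with hB
  have hB0 : 0 ≤ B := integral_nonneg fun s => by positivity
  have hrhs : ENNReal.ofReal m ^ (α' / α - 1) * (2 * ENNReal.ofReal m * ENNReal.ofReal B)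
      = ENNReal.ofReal (2 * m ^ (α' / α) * B) := by
    have h2 : (2 : ENNReal) = ENNReal.ofReal 2 := by simp
    rw [ENNReal.ofReal_rpow_of_pos hm0, h2, ← ENNReal.ofReal_mul (by norm_num),
      ← ENNReal.ofReal_mul (by positivity), ← ENNReal.ofReal_mul (by positivity)]
    congr 1
    rw [Real.rpow_sub_one hm0.ne']
    field_simp
  rw [hrhs] at key
  set A := ∫ t, (∫ s, ‖W s * K s t * W t‖ ^ α ∂μ) ^ (α' / α) ∂μ with hA
  have hI0 : ∀ t, 0 ≤ ∫ s, ‖W s * K s t * W t‖ ^ α ∂μ :=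
    fun t => integral_nonneg fun s => by positivity
  have hA0 : 0 ≤ A := integral_nonneg fun t => Real.rpow_nonneg (hI0 t) _
  have hle : ENNReal.ofReal A ≤ ∫⁻ t, (f t * ∫⁻ s, f s * k s t ∂μ) ^ (α' / α) ∂μ := by
    rw [← Real.enorm_of_nonneg hA0]
    refine (enorm_integral_le_lintegral_enorm _).trans (lintegral_mono_ae ?_)
    filter_upwards [ae_restrict_mem measurableSet_Ioc] with t ht
    rw [Real.enorm_of_nonneg (Real.rpow_nonneg (hI0 t) _),
      ← ENNReal.ofReal_rpow_of_nonneg (hI0 t) hr0.le]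
    refine ENNReal.rpow_le_rpow ?_ hr0.le
    rw [← Real.enorm_of_nonneg (hI0 t), ← lintegral_const_mul' _ _ ENNReal.ofReal_ne_top]
    refine (enorm_integral_le_lintegral_enorm _).trans (lintegral_mono_ae ?_)
    filter_upwards [ae_restrict_mem measurableSet_Ioc] with s hs
    rw [Real.enorm_of_nonneg (by positivity), ← ENNReal.ofReal_mul (by positivity),
      ← ENNReal.ofReal_mul (by positivity)]
    refine ENNReal.ofReal_le_ofReal ?_
    have hKα : ‖K s t‖ ^ α ≤ (1 + l * |s - t|) ^ (-(α / 2)) := by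
      refine (Real.rpow_le_rpow (norm_nonneg _)
        (hK s (Set.Ioc_subset_Icc_self hs) t (Set.Ioc_subset_Icc_self ht)) hα0.le).trans_eq ?_
      rw [← Real.rpow_mul (by positivity)]
      congr 1; ring
    rw [norm_mul, norm_mul, Real.mul_rpow (by positivity) (by positivity),
      Real.mul_rpow (by positivity) (by positivity), mul_comm]
    gcongr
  have hAB : A ≤ 2 * m ^ (α' / α) * B :=
    (ENNReal.ofReal_le_ofReal_iff (by positivity)).1 (hle.trans key)
  refine (Real.rpow_le_rpow hA0 hAB (by positivity)).trans_eq ?_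
  rw [Real.mul_rpow (by positivity) hB0, hm, Real.mul_rpow (by positivity) hc1.le, mul_left_comm,
    Real.mul_rpow (by positivity) (by positivity),
    ← Real.rpow_mul hl0.le, ← Real.rpow_mul hl0.le]
  have : -(α / 2) * (α' / α) * (1 / α') = -(1 / 2) := by field_simp
  rw [this]; ring
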